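/- Let a, b > 0 and define f(t) = sinh²((a−b)t) / (sinh(2at) · sinh(2bt)) for t > 0. Then f(t) tends to (a−b)²/(4ab) as t → 0⁺; in particular (a−b)²/(4ab) is the supremum of f on (0,∞) when a ≠ b. -/

import Mathlib

open Filter Topology

theorem convexOn_sinh_Ici : ConvexOn ℝ (Set.Ici 0) Real.sinh := by
  refine convexOn_of_deriv2_nonneg' (convex_Ici 0) Real.differentiable_sinh.differentiableOn
    ?_ fun x hx => ?_
  · simpa only [Real.deriv_sinh] using Real.differentiable_cosh.differentiableOn
  · simpa [Real.deriv_sinh, Real.deriv_cosh] using hx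

theorem mul_sinh_le_mul_sinh {d s : ℝ} (hd : 0 ≤ d) (hds : d ≤ s) :
    s * Real.sinh d ≤ d * Real.sinh s := by
  rcases (hd.trans hds).eq_or_lt with rfl | hs
  · simp [le_antisymm hds hd]
  have h := convexOn_sinh_Ici.2 (Set.mem_Ici.2 hs.le) (Set.mem_Ici.2 le_rfl)
    (div_nonneg hd hs.le) (sub_nonneg.2 ((div_le_one hs).2 hds)) (by ring)
  simp only [smul_eq_mul, mul_zero, add_zero, Real.sinh_zero, div_mul_cancel₀ d hs.ne'] at h
  calc s * Real.sinh d ≤ s * (d / s * Real.sinh s) := by gcongr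
    _ = d * Real.sinh s := by field_simp

theorem sq_mul_sinh_sq_le {d s : ℝ} (hds : |d| ≤ s) :
    s ^ 2 * Real.sinh d ^ 2 ≤ d ^ 2 * Real.sinh s ^ 2 := by
  have h := pow_le_pow_left₀ (mul_nonneg ((abs_nonneg d).trans hds)
    (Real.sinh_nonneg_iff.2 (abs_nonneg d))) (mul_sinh_le_mul_sinh (abs_nonneg d) hds) 2
  rw [mul_pow, mul_pow, sq_abs] at h
  rcases abs_choice d with hd | hd <;> rw [hd] at h
  · exact h
  · rwa [Real.sinh_neg, neg_sq] at h

theorem sinh_two_mul_mul_sinh_two_mul (x y : ℝ) :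
    Real.sinh (2 * x) * Real.sinh (2 * y) = Real.sinh (x + y) ^ 2 - Real.sinh (x - y) ^ 2 := by
  rw [Real.sinh_two_mul, Real.sinh_two_mul, Real.sinh_add, Real.sinh_sub]
  ring

theorem four_mul_mul_sinh_sub_sq_le {x y : ℝ} (hx : 0 ≤ x) (hy : 0 ≤ y) :
    4 * x * y * Real.sinh (x - y) ^ 2 ≤
      (x - y) ^ 2 * (Real.sinh (2 * x) * Real.sinh (2 * y)) := by
  have h : |x - y| ≤ x + y := abs_le.2 ⟨by linarith, by linarith⟩
  rw [sinh_two_mul_mul_sinh_two_mul]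
  linarith [sq_mul_sinh_sq_le h]

theorem tendsto_sinh_mul_div (c : ℝ) :
    Tendsto (fun t => Real.sinh (c * t) / t) (𝓝[>] 0) (𝓝 c) := by
  have h : HasDerivAt (fun t => Real.sinh (c * t)) c 0 := by
    simpa using ((hasDerivAt_id (0 : ℝ)).const_mul c).sinh
  have h' := h.tendsto_slope_zero_right
  simpa [div_eq_inv_mul] using h'

/-- For `a, b > 0`, the function `f(t) = sinh²((a−b)t)/(sinh(2at)·sinh(2bt))`
tends to `(a−b)²/(4ab)` as `t → 0⁺`; in particular, when `a ≠ b`, the value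
`(a−b)²/(4ab)` is the supremum (least upper bound) of `f` on `(0, ∞)`. -/
theorem nn_lemma_limit_and_sup (a b : ℝ) (ha : 0 < a) (hb : 0 < b)
    (f : ℝ → ℝ)
    (hf : ∀ t, f t = Real.sinh ((a - b) * t) ^ 2 /
      (Real.sinh (2 * a * t) * Real.sinh (2 * b * t))) :
    Tendsto f (𝓝[>] (0 : ℝ)) (𝓝 ((a - b) ^ 2 / (4 * a * b))) ∧
      (a ≠ b → IsLUB (f '' Set.Ioi (0 : ℝ)) ((a - b) ^ 2 / (4 * a * b))) := by
  have hlim : Tendsto f (𝓝[>] (0 : ℝ)) (𝓝 ((a - b) ^ 2 / (4 * a * b))) := by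
    have h := ((tendsto_sinh_mul_div (a - b)).pow 2).div
      ((tendsto_sinh_mul_div (2 * a)).mul (tendsto_sinh_mul_div (2 * b))) (by positivity)
    rw [show 2 * a * (2 * b) = 4 * a * b by ring] at h
    refine h.congr' ?_
    filter_upwards [self_mem_nhdsWithin] with t ht
    have ht0 : t ≠ 0 := (Set.mem_Ioi.1 ht).ne'
    rw [hf, Pi.div_apply, div_pow, div_mul_div_comm, ← sq,
      div_div_div_cancel_right₀ (pow_ne_zero 2 ht0)]
  refine ⟨hlim, fun _ => ⟨?_, fun u hu => ?_⟩⟩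
  · rintro _ ⟨t, ht, rfl⟩
    have ht : 0 < t := ht
    have h := four_mul_mul_sinh_sub_sq_le (mul_pos ha ht).le (mul_pos hb ht).le
    rw [← sub_mul, ← mul_assoc 2 a, ← mul_assoc 2 b] at h
    have hA : 0 < Real.sinh (2 * a * t) := Real.sinh_pos_iff.2 (by positivity)
    have hB : 0 < Real.sinh (2 * b * t) := Real.sinh_pos_iff.2 (by positivity)
    rw [hf, div_le_div_iff₀ (by positivity) (by positivity)]
    refine le_of_mul_le_mul_left ?_ (pow_pos ht 2)
    linarith
  · refine le_of_tendsto hlim ?_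
    filter_upwards [self_mem_nhdsWithin] with t ht
    exact hu ⟨t, ht, rfl⟩
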